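/- Let D ∈ W_1. Then [x_1∂_j, D] ∈ W_1'' = {f𝔇 : f ∈ O_1} for all j ≥ 2 if and only if D = f𝔇 + x_1^2·Σ_{j≥2} k_j ∂_j for some f ∈ O_1 and scalars k_j ∈ F. -/

import Mathlib

open Finset

namespace Cartan

/-- Monomial index set for the divided power superalgebra `O(m,n)`:
a multi-exponent `α : Fin m → Fin p` (divided powers truncated at `p-1`)
together with a subset of the odd variables. -/
abbrev Mon (p m n : ℕ) := (Fin m → Fin p) × Finset (Fin n)

/-- The divided power superalgebra `O(m,n)` realized as coefficient functions on monomials. -/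
abbrev O (F : Type*) [Field F] (p m n : ℕ) := Mon p m n → F

/-- The Witt superalgebra `W(m,n)` realized as tuples of coefficients:
`D : W` represents `∑ i, D i · ∂ i`. -/
abbrev W (F : Type*) [Field F] (p m n : ℕ) := Fin (m + n) → O F p m n

variable {F : Type*} [Field F] {p m n : ℕ}

/-- `ℤ₂`-parity of a monomial. -/
def parMon (μ : Mon p m n) : ZMod 2 := (μ.2.card : ZMod 2)

/-- `ℤ`-degree of a monomial (each variable has degree 1). -/
def zdMon (μ : Mon p m n) : ℕ := (∑ i, (μ.1 i : ℕ)) + μ.2.card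

/-- Parity of the index `i`: even if `i < m`, odd otherwise. -/
def parIdx (m : ℕ) {k : ℕ} (i : Fin k) : ZMod 2 := if (i : ℕ) < m then 0 else 1

/-- The constant function `1 ∈ O(m,n)`. -/
def oneO (F : Type*) [Field F] (p m n : ℕ) [NeZero p] : O F p m n :=
  fun μ => if μ.1 = 0 ∧ μ.2 = (∅ : Finset (Fin n)) then 1 else 0

/-- Koszul sign for multiplying exterior monomials `x^s · x^t`. -/
def extSign {n : ℕ} (s t : Finset (Fin n)) : ℤ :=
  (-1) ^ ∑ i ∈ t, (s.filter fun j => i < j).card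

/-- Multiplication of the divided power superalgebra `O(m,n)`:
`x^(α)x^u · x^(β)x^v = (Koszul sign) · ∏ binom(α+β,α) · x^(α+β) x^(u∪v)`. -/
def mulO [NeZero p] (f g : O F p m n) : O F p m n := fun μ =>
  ∑ ν : Mon p m n, ∑ κ : Mon p m n,
    if (∀ i, (ν.1 i : ℕ) + (κ.1 i : ℕ) = (μ.1 i : ℕ)) ∧ ν.2 ∩ κ.2 = ∅ ∧ ν.2 ∪ κ.2 = μ.2 then
      ((extSign ν.2 κ.2 : ℤ) : F) * (∏ i, (((μ.1 i : ℕ).choose (ν.1 i : ℕ) : ℕ) : F))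
        * f ν * g κ
    else 0

/-- The even partial superderivation `∂_i`, `i ≤ m`, on `O(m,n)`. -/
def dEv [NeZero p] (i : Fin m) (f : O F p m n) : O F p m n := fun μ =>
  if h : (μ.1 i : ℕ) + 1 < p then f (Function.update μ.1 i ⟨(μ.1 i : ℕ) + 1, h⟩, μ.2) else 0

/-- The odd partial superderivation `∂_{m+i}` on `O(m,n)`. -/
def dOd (i : Fin n) (f : O F p m n) : O F p m n := fun μ =>
  if i ∈ μ.2 then 0
  else ((-1 : F)) ^ (μ.2.filter fun j => j < i).card * f (μ.1, insert i μ.2)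

/-- The partial superderivation `∂_i`, `i ∈ I = {1,…,m+n}`. -/
def pd [NeZero p] (i : Fin (m + n)) (f : O F p m n) : O F p m n :=
  Sum.elim (fun j => dEv j f) (fun j => dOd j f) (finSumFinEquiv.symm i)

/-- The variable `x_i` as an element of `O(m,n)`. -/
def xVar [NeZero p] (i : Fin (m + n)) : O F p m n := fun μ =>
  if h : (i : ℕ) < m then
    (if μ.1 = Pi.single (⟨i, h⟩ : Fin m) 1 ∧ μ.2 = (∅ : Finset (Fin n)) then 1 else 0)
  else
    (if μ.1 = 0 ∧ μ.2 = {(⟨(i : ℕ) - m, by have := i.isLt; omega⟩ : Fin n)} then 1 else 0)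

/-- Projection of `f ∈ O(m,n)` onto its parity-`b` component. -/
def projO (b : ZMod 2) (f : O F p m n) : O F p m n :=
  fun μ => if parMon μ = b then f μ else 0

/-- Projection of `D ∈ W(m,n)` onto its parity-`b` component
(the parity of `f ∂_i` is `|f| + |∂_i|`). -/
def projW (b : ZMod 2) (D : W F p m n) : W F p m n :=
  fun i => projO (b + parIdx m i) (D i)

/-- `f` is `ℤ₂`-homogeneous of parity `b`. -/
def isParO (b : ZMod 2) (f : O F p m n) : Prop := ∀ μ, f μ ≠ 0 → parMon μ = b

/-- `D` is `ℤ₂`-homogeneous of parity `b`. -/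
def isParW (b : ZMod 2) (D : W F p m n) : Prop := ∀ i, isParO (b + parIdx m i) (D i)

/-- Action of a superderivation `D = ∑ f_i ∂_i` on `g ∈ O(m,n)`: `D(g) = ∑ f_i · ∂_i(g)`. -/
def act [NeZero p] (D : W F p m n) (g : O F p m n) : O F p m n :=
  ∑ i, mulO (D i) (pd i g)

/-- Super-commutator bracket on `W(m,n)`, extended bilinearly from homogeneous components:
`[D,E] = D∘E - (-1)^{|D||E|} E∘D`, recorded via values on the generators `x_k`. -/
def bracketW [NeZero p] (D E : W F p m n) : W F p m n :=
  ∑ a : ZMod 2, ∑ b : ZMod 2,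
    (fun k => act (projW a D) (projW b E k)
      - ((-1 : F)) ^ (a * b).val • act (projW b E) (projW a D k) : W F p m n)

/-- Divergence: `div(f ∂_i) = (-1)^{|f||∂_i|} ∂_i(f)`, extended linearly. -/
def divW [NeZero p] (D : W F p m n) : O F p m n :=
  ∑ i, ∑ b : ZMod 2, ((-1 : F)) ^ (b * parIdx m i).val • pd i (projO b (D i))

/-- The Euler (degree) derivation `𝔇 = ∑ x_k ∂_k`. -/
def euler (F : Type*) [Field F] (p m n : ℕ) [NeZero p] : W F p m n := fun i => xVar i

/-- The derivation `f𝔇 = ∑ (f·x_k) ∂_k`. -/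
def fEuler [NeZero p] (f : O F p m n) : W F p m n := fun i => mulO f (xVar i)

/-- `f` is `ℤ`-homogeneous of degree `s` (i.e. `f ∈ O_s`). -/
def inO (s : ℤ) (f : O F p m n) : Prop := ∀ μ, f μ ≠ 0 → (zdMon μ : ℤ) = s

/-- `D ∈ W_s` for the standard grading (`zd(f∂_i) = zd(f) - 1`). -/
def inW (s : ℤ) (D : W F p m n) : Prop := ∀ i, inO (s + 1) (D i)

/-- The superderivation `∂_i` as an element of `W(m,n)`. -/
def delOp (F : Type*) [Field F] (p m n : ℕ) [NeZero p] (i : Fin (m + n)) : W F p m n :=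
  fun k => if k = i then oneO F p m n else 0

/-- The `ℤ`-graded component `W_s` as a submodule. -/
def Wgrade (F : Type*) [Field F] (p m n : ℕ) (s : ℤ) : Submodule F (W F p m n) where
  carrier := {D | inW s D}
  add_mem' := by
    intro a b ha hb i μ h
    by_cases h1 : a i μ = 0
    · exact hb i μ (by simpa [h1] using h)
    · exact ha i μ h1
  zero_mem' := by intro i μ h; simp at h
  smul_mem' := by
    intro c a ha i μ h
    refine ha i μ (fun h1 => h ?_)
    simp [h1]


lemma xVar_ev [NeZero p] (i : Fin m) (μ : Mon p m n) :
    (xVar (Fin.castAdd n i) : O F p m n) μ =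
      if μ = ((Pi.single i 1 : Fin m → Fin p), (∅ : Finset (Fin n))) then 1 else 0 := by
  simp [xVar, Prod.ext_iff]

lemma xVar_od [NeZero p] (i : Fin n) (μ : Mon p m n) :
    (xVar (Fin.natAdd m i) : O F p m n) μ =
      if μ = ((0 : Fin m → Fin p), ({i} : Finset (Fin n))) then 1 else 0 := by
  simp [xVar, Prod.ext_iff]

/-- Lower the `i`-th even exponent by one. -/
def dn (i : Fin m) (μ : Mon p m n) : Mon p m n :=
  (Function.update μ.1 i ⟨(μ.1 i : ℕ) - 1, by have := (μ.1 i).isLt; omega⟩, μ.2)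

lemma mulO_add_right [NeZero p] (f g h : O F p m n) : mulO f (g + h) = mulO f g + mulO f h := by
  funext μ
  simp only [mulO, Pi.add_apply, ← Finset.sum_add_distrib]
  refine Finset.sum_congr rfl fun ν _ => Finset.sum_congr rfl fun κ _ => ?_
  split_ifs <;> ring

lemma mulO_smul_right [NeZero p] (c : F) (f g : O F p m n) : mulO f (c • g) = c • mulO f g := by
  funext μ
  simp only [mulO, Pi.smul_apply, smul_eq_mul, Finset.mul_sum]
  refine Finset.sum_congr rfl fun ν _ => Finset.sum_congr rfl fun κ _ => ?_
  split_ifs <;> ring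

lemma mulO_add_left [NeZero p] (f g h : O F p m n) : mulO (f + g) h = mulO f h + mulO g h := by
  funext μ
  simp only [mulO, Pi.add_apply, ← Finset.sum_add_distrib]
  refine Finset.sum_congr rfl fun ν _ => Finset.sum_congr rfl fun κ _ => ?_
  split_ifs <;> ring

lemma mulO_smul_left [NeZero p] (c : F) (f g : O F p m n) : mulO (c • f) g = c • mulO f g := by
  funext μ
  simp only [mulO, Pi.smul_apply, smul_eq_mul, Finset.mul_sum]
  refine Finset.sum_congr rfl fun ν _ => Finset.sum_congr rfl fun κ _ => ?_
  split_ifs <;> ring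

lemma mulO_zero_left [NeZero p] (g : O F p m n) : mulO 0 g = 0 := by
  simpa using mulO_smul_left (0 : F) 0 g

lemma mulO_zero_right [NeZero p] (g : O F p m n) : mulO g 0 = 0 := by
  simpa using mulO_smul_right (0 : F) g 0

lemma pd_add [NeZero p] (i : Fin (m + n)) (f g : O F p m n) : pd i (f + g) = pd i f + pd i g := by
  refine Fin.addCases (fun i => ?_) (fun i => ?_) i <;> funext μ
  · simp only [pd, finSumFinEquiv_symm_apply_castAdd, Sum.elim_inl, dEv, Pi.add_apply]
    split_ifs <;> simp
  · simp only [pd, finSumFinEquiv_symm_apply_natAdd, Sum.elim_inr, dOd, Pi.add_apply]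
    split_ifs <;> ring

lemma pd_smul [NeZero p] (i : Fin (m + n)) (c : F) (f : O F p m n) : pd i (c • f) = c • pd i f := by
  refine Fin.addCases (fun i => ?_) (fun i => ?_) i <;> funext μ
  · simp only [pd, finSumFinEquiv_symm_apply_castAdd, Sum.elim_inl, dEv, Pi.smul_apply]
    split_ifs <;> simp
  · simp only [pd, finSumFinEquiv_symm_apply_natAdd, Sum.elim_inr, dOd, Pi.smul_apply, smul_eq_mul]
    split_ifs <;> ring

lemma pd_zero [NeZero p] (i : Fin (m + n)) : pd i (0 : O F p m n) = 0 := by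
  simpa using pd_smul i (0 : F) (0 : O F p m n)

lemma val_single [NeZero p] (hp : 1 < p) (i k : Fin m) :
    (((Pi.single i 1 : Fin m → Fin p) k : Fin p) : ℕ) = if k = i then 1 else 0 := by
  by_cases h : k = i
  · subst h; simp [Nat.mod_eq_of_lt hp]
  · simp [h]

lemma extSign_empty_right (s : Finset (Fin n)) : extSign s ∅ = 1 := by simp [extSign]

lemma extSign_empty_left (s : Finset (Fin n)) : extSign ∅ s = 1 := by simp [extSign]

lemma mulO_ev [NeZero p] (hp : 1 < p) (f : O F p m n) (i : Fin m) (μ : Mon p m n) :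
    mulO f (xVar (Fin.castAdd n i)) μ = ((μ.1 i : ℕ) : F) * f (dn i μ) := by
  simp only [mulO, xVar_ev]
  rw [Finset.sum_eq_single (dn i μ)]
  · rw [Finset.sum_eq_single ((Pi.single i 1 : Fin m → Fin p), (∅ : Finset (Fin n)))]
    · simp only [val_single hp, dn, extSign_empty_right]
      by_cases h : (μ.1 i : ℕ) = 0
      · rw [if_neg]
        · simp [h]
        · intro h'
          have := h'.1 i
          simp [h] at this
      · rw [if_pos]
        · rw [Finset.prod_eq_single i]
          · have : ((μ.1 i : ℕ)).choose ((μ.1 i : ℕ) - 1) = (μ.1 i : ℕ) := by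
              obtain ⟨t, ht⟩ := Nat.exists_eq_succ_of_ne_zero h
              rw [ht]; simp
            simp [this]
          · intro b _ hb
            simp [Function.update_of_ne hb]
          · simp
        · refine ⟨fun k => ?_, by simp, by simp⟩
          by_cases hk : k = i
          · subst hk; simp; omega
          · simp [hk]
    · intro κ _ hκ
      simp [hκ]
    · simp
  · intro ν _ hν
    apply Finset.sum_eq_zero
    intro κ _
    by_cases hκ : κ = ((Pi.single i 1 : Fin m → Fin p), (∅ : Finset (Fin n)))
    · rw [if_neg]
      rintro ⟨h1, h2, h3⟩
      apply hν
      subst hκ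
      simp only [val_single hp] at h1
      refine Prod.ext (funext fun k => Fin.ext ?_) (by simpa [dn] using h3)
      have := h1 k
      by_cases hk : k = i
      · subst hk; simp [dn] at this ⊢; omega
      · simp [dn, hk] at this ⊢; omega
    · simp [hκ]
  · simp

lemma mulO_x_left [NeZero p] (hp : 1 < p) (f : O F p m n) (i : Fin m) (μ : Mon p m n) :
    mulO (xVar (Fin.castAdd n i)) f μ = ((μ.1 i : ℕ) : F) * f (dn i μ) := by
  simp only [mulO, xVar_ev]
  rw [Finset.sum_comm]
  rw [Finset.sum_eq_single (dn i μ)]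
  · rw [Finset.sum_eq_single ((Pi.single i 1 : Fin m → Fin p), (∅ : Finset (Fin n)))]
    · simp only [val_single hp, dn, extSign_empty_left]
      by_cases h : (μ.1 i : ℕ) = 0
      · rw [if_neg]
        · simp [h]
        · intro h'
          have := h'.1 i
          simp [h] at this
      · rw [if_pos]
        · rw [Finset.prod_eq_single i]
          · simp
          · intro b _ hb
            simp [hb]
          · simp
        · refine ⟨fun k => ?_, by simp, by simp⟩
          by_cases hk : k = i
          · subst hk; simp; omega
          · simp [hk]
    · intro κ _ hκ
      simp [hκ]
    · simp
  · intro ν _ hν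
    apply Finset.sum_eq_zero
    intro κ _
    by_cases hκ : κ = ((Pi.single i 1 : Fin m → Fin p), (∅ : Finset (Fin n)))
    · rw [if_neg]
      rintro ⟨h1, h2, h3⟩
      apply hν
      subst hκ
      simp only [val_single hp] at h1
      refine Prod.ext (funext fun k => Fin.ext ?_) (by simpa [dn] using h3)
      have := h1 k
      by_cases hk : k = i
      · subst hk; simp [dn] at this ⊢; omega
      · simp [dn, hk] at this ⊢; omega
    · simp [hκ]
  · simp

lemma mulO_od [NeZero p] (f : O F p m n) (i : Fin n) (μ : Mon p m n) :
    mulO f (xVar (Fin.natAdd m i)) μ =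
      if i ∈ μ.2 then (-1 : F) ^ (μ.2.filter fun j => i < j).card * f (μ.1, μ.2.erase i)
      else 0 := by
  simp only [mulO, xVar_od]
  rw [Finset.sum_eq_single (μ.1, μ.2.erase i)]
  · rw [Finset.sum_eq_single ((0 : Fin m → Fin p), ({i} : Finset (Fin n)))]
    · by_cases h : i ∈ μ.2
      · rw [if_pos, if_pos h]
        · have : ((μ.2.erase i).filter fun j => i < j) = μ.2.filter fun j => i < j := by
            ext j; simp only [mem_filter, mem_erase]
            constructor
            · tauto
            · rintro ⟨h1, h2⟩; exact ⟨⟨h2.ne', h1⟩, h2⟩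
          simp [extSign, this]
        · refine ⟨by simp, by simp, ?_⟩
          ext j; by_cases hj : j = i <;> simp [hj, h]
      · rw [if_neg, if_neg h]
        rintro ⟨-, -, h3⟩
        apply h; rw [← h3]; simp
    · intro κ _ hκ
      simp [hκ]
    · simp
  · intro ν _ hν
    apply Finset.sum_eq_zero
    intro κ _
    by_cases hκ : κ = ((0 : Fin m → Fin p), ({i} : Finset (Fin n)))
    · rw [if_neg]
      rintro ⟨h1, h2, h3⟩
      apply hν
      subst hκ
      refine Prod.ext (funext fun k => Fin.ext ?_) ?_
      · simpa using h1 k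
      · simp only at h2 h3
        have hi : i ∉ ν.2 := by
          intro hi
          have : i ∈ ν.2 ∩ {i} := by simp [hi]
          rw [h2] at this; simp at this
        simp only [← h3]
        ext j; by_cases hj : j = i <;> simp [hj, hi]
    · simp [hκ]
  · simp

lemma mulO_one [NeZero p] (f : O F p m n) : mulO f (oneO F p m n) = f := by
  funext μ
  simp only [mulO, oneO]
  rw [Finset.sum_eq_single μ]
  · rw [Finset.sum_eq_single ((0 : Fin m → Fin p), (∅ : Finset (Fin n)))]
    · simp [extSign]
    · intro κ _ hκ
      have : ¬ (κ.1 = 0 ∧ κ.2 = ∅) := fun h => hκ (Prod.ext h.1 h.2)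
      simp [this]
    · simp
  · intro ν _ hν
    apply Finset.sum_eq_zero
    intro κ _
    by_cases hκ : κ.1 = 0 ∧ κ.2 = ∅
    · rw [if_neg]
      rintro ⟨h1, h2, h3⟩
      apply hν
      refine Prod.ext (funext fun k => Fin.ext ?_) ?_
      · simpa [hκ.1] using h1 k
      · simpa [hκ.2] using h3
    · simp [hκ]
  · simp

lemma one_mulO [NeZero p] (f : O F p m n) : mulO (oneO F p m n) f = f := by
  funext μ
  simp only [mulO, oneO]
  rw [Finset.sum_comm, Finset.sum_eq_single μ]
  · rw [Finset.sum_eq_single ((0 : Fin m → Fin p), (∅ : Finset (Fin n)))]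
    · simp [extSign]
    · intro κ _ hκ
      have : ¬ (κ.1 = 0 ∧ κ.2 = ∅) := fun h => hκ (Prod.ext h.1 h.2)
      simp [this]
    · simp
  · intro ν _ hν
    apply Finset.sum_eq_zero
    intro κ _
    by_cases hκ : κ.1 = 0 ∧ κ.2 = ∅
    · rw [if_neg]
      rintro ⟨h1, h2, h3⟩
      apply hν
      refine Prod.ext (funext fun k => Fin.ext ?_) ?_
      · simpa [hκ.1] using h1 k
      · simpa [hκ.2] using h3
    · simp [hκ]
  · simp

/-- Parity twist. -/
def sg (j : Fin (m + n)) (f : O F p m n) : O F p m n :=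
  fun μ => (-1 : F) ^ (parIdx m j * parMon μ).val * f μ

lemma pd_ev [NeZero p] (i : Fin m) (f : O F p m n) (μ : Mon p m n) :
    pd (Fin.castAdd n i) f μ = if h : (μ.1 i : ℕ) + 1 < p then
      f (Function.update μ.1 i ⟨(μ.1 i : ℕ) + 1, h⟩, μ.2) else 0 := by
  simp [pd, dEv]

lemma pd_od [NeZero p] (i : Fin n) (f : O F p m n) (μ : Mon p m n) :
    pd (Fin.natAdd m i) f μ = if i ∈ μ.2 then 0
      else ((-1 : F)) ^ (μ.2.filter fun j => j < i).card * f (μ.1, insert i μ.2) := by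
  simp [pd, dOd]

lemma parIdx_ev (i : Fin m) : parIdx m (Fin.castAdd n i) = 0 := by simp [parIdx]
lemma parIdx_od (i : Fin n) : parIdx m (Fin.natAdd m i) = 1 := by simp [parIdx]

lemma neg_one_pow_val (c : ℕ) : (-1 : F) ^ ((c : ZMod 2)).val = (-1) ^ c := by
  rw [ZMod.val_natCast, neg_one_pow_eq_pow_mod_two c]

lemma sg_ev (i : Fin m) (f : O F p m n) : sg (Fin.castAdd n i) f = f := by
  funext μ; simp [sg, parIdx_ev]

lemma sg_od (i : Fin n) (f : O F p m n) (μ : Mon p m n) :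
    sg (Fin.natAdd m i) f μ = (-1) ^ μ.2.card * f μ := by
  simp only [sg, parIdx_od, parMon, one_mul, neg_one_pow_val]

lemma card_split (i : Fin n) (s : Finset (Fin n)) :
    s.card = (s.filter fun j => j < i).card + (s.filter fun j => i < j).card
      + if i ∈ s then 1 else 0 := by
  rw [← Finset.card_filter_add_card_filter_not (s := s) (fun j => j < i), add_assoc]
  congr 1
  have h : (s.filter fun j => ¬ j < i) = (s.filter fun j => i < j) ∪ (s.filter fun j => j = i) := by
    ext j; simp only [mem_filter, mem_union, not_lt, le_iff_lt_or_eq]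
    constructor
    · rintro ⟨a, b | b⟩
      · exact Or.inl ⟨a, b⟩
      · exact Or.inr ⟨a, b.symm⟩
    · rintro (⟨a, b⟩ | ⟨a, b⟩)
      · exact ⟨a, Or.inl b⟩
      · exact ⟨a, Or.inr b.symm⟩
  rw [h, Finset.card_union_of_disjoint]
  · congr 1
    rw [Finset.filter_eq' s i]; split_ifs <;> simp
  · rw [Finset.disjoint_left]; intro a; simp only [mem_filter]; rintro ⟨_, h1⟩ ⟨_, h2⟩
    exact h1.ne' h2

lemma leib [NeZero p] [CharP F p] (hp : 1 < p) (j k : Fin (m + n)) (f : O F p m n) :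
    pd j (mulO f (xVar k)) = mulO (pd j f) (xVar k) + if k = j then sg j f else 0 := by
  induction j using Fin.addCases with
  | left j =>
    induction k using Fin.addCases with
    | left k =>
      funext μ
      simp only [pd_ev, mulO_ev hp, Pi.add_apply, sg_ev]
      by_cases hk : k = j
      · subst hk
        simp only [if_true]
        rcases Nat.eq_zero_or_pos (μ.1 k : ℕ) with h0 | h0
        · have h1 : (μ.1 k : ℕ) + 1 < p := by omega
          have h2 : dn k (Function.update μ.1 k ⟨(μ.1 k : ℕ) + 1, h1⟩, μ.2) = μ := by
            refine Prod.ext (funext fun i => Fin.ext ?_) rfl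
            by_cases hi : i = k
            · subst hi; simp [dn]
            · simp [dn, hi]
          rw [dif_pos h1, h2]
          simp [h0]
        · have h3 : (((dn k μ).1 k : Fin p) : ℕ) = (μ.1 k : ℕ) - 1 := by simp [dn]
          have h3' : (((dn k μ).1 k : Fin p) : ℕ) + 1 < p := by
            have := (μ.1 k).isLt; omega
          have h4 : (Function.update (dn k μ).1 k ⟨(((dn k μ).1 k : Fin p) : ℕ) + 1, h3'⟩,
              (dn k μ).2) = μ := by
            refine Prod.ext (funext fun i => Fin.ext ?_) rfl
            by_cases hi : i = k
            · subst hi; simp [dn]; omega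
            · simp [dn, hi]
          rw [dif_pos h3', h4]
          split_ifs with h1
          · have h2 : dn k (Function.update μ.1 k ⟨(μ.1 k : ℕ) + 1, h1⟩, μ.2) = μ := by
              refine Prod.ext (funext fun i => Fin.ext ?_) rfl
              by_cases hi : i = k
              · subst hi; simp [dn]
              · simp [dn, hi]
            rw [h2]; simp; ring
          · have h5 : (μ.1 k : ℕ) + 1 = p := by
              have := (μ.1 k).isLt; omega
            have h6 : (((μ.1 k : ℕ) + 1 : ℕ) : F) = 0 := by rw [h5]; exact CharP.cast_eq_zero F p
            push_cast at h6
            linear_combination -(f μ) * h6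
      · have hk' : ¬ (Fin.castAdd n k = Fin.castAdd n j) := by simpa [Fin.ext_iff] using hk
        simp only [hk', if_false, Pi.zero_apply, add_zero]
        have e : (((dn k μ).1 j : Fin p) : ℕ) = (μ.1 j : ℕ) := by
          simp [dn, Function.update_of_ne (Ne.symm hk)]
        by_cases h1 : (μ.1 j : ℕ) + 1 < p
        · rw [dif_pos h1, dif_pos (by omega)]
          simp only [Function.update_of_ne hk]
          congr 2
          refine Prod.ext (funext fun i => Fin.ext ?_) rfl
          by_cases hi : i = k
          · subst hi; simp [dn, hk]
          · by_cases hi' : i = j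
            · subst hi'; simp [dn, hi]
            · simp [dn, hi, hi']
        · rw [dif_neg h1, dif_neg (by omega), mul_zero]
    | right k =>
      funext μ
      have hk' : ¬ (Fin.natAdd m k = Fin.castAdd n j) := by
        have := j.isLt
        simp [Fin.ext_iff]; omega
      simp only [pd_ev, mulO_od, hk', if_false, Pi.add_apply, Pi.zero_apply, add_zero]
      split_ifs <;> simp
  | right j =>
    induction k using Fin.addCases with
    | left k =>
      funext μ
      have hk' : ¬ (Fin.castAdd n k = Fin.natAdd m j) := by
        have := k.isLt
        simp [Fin.ext_iff]; omega
      simp only [pd_od, mulO_ev hp, hk', if_false, Pi.add_apply, Pi.zero_apply, add_zero, dn]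
      split_ifs
      · simp
      · ring
    | right k =>
      funext μ
      simp only [pd_od, mulO_od, Pi.add_apply]
      by_cases hk : k = j
      · subst hk
        simp only [if_true, sg_od, mem_insert, true_or]
        have hc := card_split k μ.2
        by_cases h : k ∈ μ.2
        · have e1 : ((μ.2.erase k).filter fun j => j < k) = μ.2.filter fun j => j < k := by
            ext j; simp only [mem_filter, mem_erase]
            constructor
            · tauto
            · rintro ⟨h1, h2⟩; exact ⟨⟨h2.ne, h1⟩, h2⟩
          simp only [h, if_true] at hc
          simp only [h, if_true, mem_erase, ne_eq, not_true, false_and, if_false, e1,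
            Finset.insert_erase h, hc]
          ring
        · have e1 : ((insert k μ.2).filter fun j => k < j) = μ.2.filter fun j => k < j := by
            rw [Finset.filter_insert, if_neg (lt_irrefl _)]
          simp only [h, if_false] at hc
          simp only [h, if_false, e1, Finset.erase_insert h, hc]
          ring
      · have hk' : ¬ (Fin.natAdd m k = Fin.natAdd m j) := by simpa [Fin.ext_iff] using hk
        simp only [hk', if_false, Pi.zero_apply, add_zero, mem_insert, hk, false_or, mem_erase]
        by_cases hj : j ∈ μ.2
        · simp [hj, Ne.symm hk]
        · by_cases hkm : k ∈ μ.2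
          · simp only [hj, hkm, if_true, if_false, and_false]
            have e0 : (insert j μ.2).erase k = insert j (μ.2.erase k) := by
              rw [Finset.erase_insert_of_ne (Ne.symm hk)]
            rw [e0]
            rcases lt_or_gt_of_ne hk with hlt | hlt
            · have e1 : ((insert j μ.2).filter fun i => k < i).card
                  = (μ.2.filter fun i => k < i).card + 1 := by
                rw [Finset.filter_insert, if_pos hlt, Finset.card_insert_of_notMem (by simp [hj])]
              have e2 : (μ.2.filter fun i => i < j).card
                  = ((μ.2.erase k).filter fun i => i < j).card + 1 := by
                rw [Finset.filter_erase, Finset.card_erase_add_one]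
                simp [hkm, hlt]
              rw [e1, e2]; ring
            · have e1 : ((insert j μ.2).filter fun i => k < i)
                  = (μ.2.filter fun i => k < i) := by
                rw [Finset.filter_insert, if_neg hlt.asymm]
              have e2 : ((μ.2.erase k).filter fun i => i < j)
                  = (μ.2.filter fun i => i < j) := by
                rw [Finset.filter_erase, Finset.erase_eq_of_notMem]
                simp [hkm, hlt.le]
              rw [e1, e2]; ring
          · simp [hkm]

lemma pd_xVar [NeZero p] [CharP F p] (hp : 1 < p) (i k : Fin (m + n)) :
    pd i (xVar k : O F p m n) = if k = i then oneO F p m n else 0 := by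
  have h := leib hp i k (oneO F p m n)
  rw [one_mulO] at h
  have h1 : pd i (oneO F p m n) = 0 := by
    funext μ
    induction i using Fin.addCases with
    | left i =>
      simp only [pd_ev, oneO, Pi.zero_apply]
      split_ifs with h1 h2
      · have := congrArg Fin.val (congrFun h2.1 i)
        simp at this
      · rfl
      · rfl
    | right i =>
      simp [pd_od, oneO]
  have h2 : sg i (oneO F p m n) = oneO F p m n := by
    funext μ
    simp only [sg, oneO]
    split_ifs with h
    · simp [parMon, h.2]
    · simp
  rw [h, h1, h2, mulO_zero_left, zero_add]

/-- The element `x_k ∂_j`. -/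
def xd [NeZero p] (z : Fin m) (j : Fin (m + n)) : W F p m n :=
  fun k => if k = j then xVar (Fin.castAdd n z) else 0

lemma projW_xd [NeZero p] (z : Fin m) (j : Fin (m + n)) (a : ZMod 2) :
    projW a (xd z j : W F p m n) = if a = parIdx m j then xd z j else 0 := by
  funext k μ
  by_cases hk : k = j
  · subst hk
    simp only [projW, projO, xd, if_true, xVar_ev]
    have h2 : ∀ a b : ZMod 2, 0 = a + b ↔ a = b := by decide
    by_cases hμ : μ = ((Pi.single z 1 : Fin m → Fin p), (∅ : Finset (Fin n)))
    · subst hμ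
      simp only [parMon, Finset.card_empty, Nat.cast_zero, h2]
      split_ifs <;> simp [xd, xVar_ev]
    · split_ifs <;> simp [xd, xVar_ev, hμ]
  · simp only [projW, projO, xd, hk, if_false]
    split_ifs <;> simp [xd, hk]

lemma act_xd [NeZero p] (z : Fin m) (j : Fin (m + n)) (g : O F p m n) :
    act (xd z j) g = mulO (xVar (Fin.castAdd n z)) (pd j g) := by
  simp only [act, xd]
  rw [Finset.sum_eq_single j]
  · simp
  · intro b _ hb; simp [hb, mulO_zero_left]
  · simp

lemma act_x [NeZero p] [CharP F p] (hp : 1 < p) (E : W F p m n) (k : Fin (m + n)) :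
    act E (xVar k) = E k := by
  simp only [act, pd_xVar hp]
  rw [Finset.sum_eq_single k]
  · simp [mulO_one]
  · intro b _ hb; simp [hb.symm, mulO_zero_right]
  · simp

lemma act_zero_left [NeZero p] (g : O F p m n) : act (0 : W F p m n) g = 0 := by
  simp [act, mulO_zero_left]

lemma act_zero_right [NeZero p] (E : W F p m n) : act E 0 = 0 := by
  simp [act, pd_zero, mulO_zero_right]

lemma sum_zmod2 {M : Type*} [AddCommMonoid M] (f : ZMod 2 → M) : ∑ a, f a = f 0 + f 1 :=
  Fin.sum_univ_two f

lemma sum_projW (E : W F p m n) (k : Fin (m + n)) : projW 0 E k + projW 1 E k = E k := by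
  funext μ
  simp only [projW, projO, Pi.add_apply]
  generalize parMon μ = a
  generalize parIdx m k = b
  have h : ∀ a b : ZMod 2, (a = 0 + b ∧ ¬ a = 1 + b) ∨ (¬ a = 0 + b ∧ a = 1 + b) := by decide
  rcases h a b with ⟨h1, h2⟩ | ⟨h1, h2⟩
  · rw [if_pos h1, if_neg h2, add_zero]
  · rw [if_neg h1, if_pos h2, zero_add]

lemma bracket_xd [NeZero p] [CharP F p] (hp : 1 < p) (z : Fin m) (j k : Fin (m + n))
    (E : W F p m n) :
    bracketW (xd z j) E k = mulO (xVar (Fin.castAdd n z)) (pd j (E k))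
      - if k = j then sg j (E (Fin.castAdd n z)) else 0 := by
  have key : bracketW (xd z j) E k = ∑ b : ZMod 2, (act (xd z j) (projW b E k)
      - ((-1 : F)) ^ (parIdx m j * b).val • act (projW b E) (xd z j k)) := by
    simp only [bracketW, Finset.sum_apply]
    rw [Finset.sum_eq_single (parIdx m j)]
    · simp [projW_xd]
    · intro a _ ha
      simp [projW_xd, ha, act_zero_left, act_zero_right]
    · simp
  rw [key, sum_zmod2, act_xd, act_xd]
  conv_rhs => rw [← sum_projW E k, pd_add, mulO_add_right]
  by_cases hk : k = j
  · subst hk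
    have e : xd z k k = (xVar (Fin.castAdd n z) : O F p m n) := by simp [xd]
    rw [e, act_x hp, act_x hp, if_pos rfl]
    have e2 : sg k (E (Fin.castAdd n z)) =
        ((-1 : F)) ^ (parIdx m k * 0).val • projW 0 E (Fin.castAdd n z)
        + ((-1 : F)) ^ (parIdx m k * 1).val • projW 1 E (Fin.castAdd n z) := by
      funext μ
      simp only [sg, projW, projO, Pi.add_apply, Pi.smul_apply, parIdx_ev, smul_eq_mul, add_zero]
      have h : ∀ a : ZMod 2, a = 0 ∨ a = 1 := by decide
      rcases h (parMon μ) with h1 | h1 <;> simp [h1]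
    rw [e2]; abel
  · have e : xd z j k = (0 : O F p m n) := by simp [xd, hk]
    rw [e, act_zero_right, act_zero_right, if_neg hk]
    simp

lemma zd_update (μ : Mon p m n) (i : Fin m) (v : Fin p) :
    zdMon ((Function.update μ.1 i v, μ.2) : Mon p m n) + (μ.1 i : ℕ) = zdMon μ + (v : ℕ) := by
  simp only [zdMon]
  rw [← Finset.add_sum_erase _ _ (Finset.mem_univ i),
    ← Finset.add_sum_erase (Finset.univ) (fun k => (μ.1 k : ℕ)) (Finset.mem_univ i)]
  have : ∑ x ∈ univ.erase i, ((Function.update μ.1 i v x : Fin p) : ℕ)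
      = ∑ x ∈ univ.erase i, (μ.1 x : ℕ) := by
    refine Finset.sum_congr rfl fun x hx => ?_
    rw [Function.update_of_ne (Finset.ne_of_mem_erase hx)]
  rw [this]; simp only [Function.update_self]; omega

lemma le_zd (μ : Mon p m n) (i : Fin m) : (μ.1 i : ℕ) + μ.2.card ≤ zdMon μ := by
  simp only [zdMon]
  have := Finset.single_le_sum (f := fun k => (μ.1 k : ℕ)) (fun _ _ => Nat.zero_le _)
    (Finset.mem_univ i)
  omega

lemma cast_ne [CharP F p] (a : ℕ) (h0 : 0 < a) (h : a < p) : (a : F) ≠ 0 := by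
  intro h1
  rw [CharP.cast_eq_zero_iff F p] at h1
  exact absurd (Nat.le_of_dvd h0 h1) (by omega)

lemma inO_pd [NeZero p] (s : ℤ) (j : Fin (m + n)) (f : O F p m n) (hf : inO (s + 1) f) :
    inO s (pd j f) := by
  intro μ h
  induction j using Fin.addCases with
  | left i =>
    rw [pd_ev] at h
    split_ifs at h with h1
    · have h2 := hf _ h
      have h3 := zd_update μ i ⟨(μ.1 i : ℕ) + 1, h1⟩
      simp only at h3
      omega
    · exact absurd rfl h
  | right i =>
    rw [pd_od] at h
    split_ifs at h with h1
    · exact absurd rfl h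
    · have h2 := hf _ (right_ne_zero_of_mul h)
      simp only [zdMon, Finset.card_insert_of_notMem h1] at h2 ⊢
      push_cast at h2 ⊢
      omega

lemma inO_zero [NeZero p] (h : O F p m n) (hh : inO 0 h) :
    h = h ((0 : Fin m → Fin p), (∅ : Finset (Fin n))) • oneO F p m n := by
  funext μ
  simp only [Pi.smul_apply, oneO, smul_eq_mul]
  split_ifs with h1
  · rw [mul_one]; congr 1; exact Prod.ext h1.1 h1.2
  · rw [mul_zero]
    by_contra h2
    have h3 := hh μ h2
    apply h1
    refine ⟨funext fun i => Fin.ext ?_, ?_⟩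
    · have := le_zd μ i
      simp only [Pi.zero_apply, Fin.val_zero]; omega
    · rw [← Finset.card_eq_zero]
      simp only [zdMon] at h3; omega

lemma inO_mulO [NeZero p] (hp : 1 < p) (f : O F p m n) (k : Fin (m + n)) (hf : inO 1 f) :
    inO (1 + 1) (mulO f (xVar k)) := by
  intro μ h
  induction k using Fin.addCases with
  | left i =>
    rw [mulO_ev hp] at h
    have h0 : (μ.1 i : ℕ) ≠ 0 := fun h0 => h (by simp [h0])
    have h1 := hf _ (right_ne_zero_of_mul h)
    have h2 := zd_update μ i ⟨(μ.1 i : ℕ) - 1, by have := (μ.1 i).isLt; omega⟩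
    simp only [dn] at h1
    simp only at h2
    omega
  | right i =>
    rw [mulO_od] at h
    split_ifs at h with h0
    · have h1 := hf _ (right_ne_zero_of_mul h)
      have h2 := Finset.card_erase_add_one h0
      simp only [zdMon] at h1 ⊢
      omega
    · exact absurd rfl h

lemma inO_xVar [NeZero p] (hp : 1 < p) (c : F) (z : Fin m) :
    inO 1 (c • xVar (Fin.castAdd n z) : O F p m n) := by
  intro μ h
  simp only [Pi.smul_apply, xVar_ev, smul_eq_mul] at h
  split_ifs at h with h1
  · subst h1
    simp [zdMon, val_single hp]
  · simp at h

lemma mulO_comm_z [NeZero p] (hp : 1 < p) (z : Fin m) (f : O F p m n) :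
    mulO (xVar (Fin.castAdd n z)) f = mulO f (xVar (Fin.castAdd n z)) := by
  funext μ; rw [mulO_ev hp, mulO_x_left hp]

lemma sg_mulO [NeZero p] (hp : 1 < p) (z : Fin m) (j : Fin (m + n)) (f : O F p m n) :
    mulO (sg j f) (xVar (Fin.castAdd n z)) = sg j (mulO f (xVar (Fin.castAdd n z))) := by
  funext μ
  simp only [sg, mulO_ev hp]
  have : parMon (dn z μ) = parMon μ := rfl
  rw [this]; ring

lemma bracket_fEuler [NeZero p] [CharP F p] (hp : 1 < p) (z : Fin m) (j : Fin (m + n))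
    (f : O F p m n) (hf : inO 1 f) :
    ∃ c : F, bracketW (xd z j) (fEuler f) = fEuler (c • xVar (Fin.castAdd n z)) := by
  have h1 := inO_zero _ (inO_pd 0 j f (by simpa using hf))
  obtain ⟨c, h1⟩ : ∃ c : F, pd j f = c • oneO F p m n := ⟨_, h1⟩
  refine ⟨c, funext fun k => ?_⟩
  · rw [bracket_xd hp]
    simp only [fEuler]
    rw [leib hp, mulO_add_right, h1, mulO_smul_left, one_mulO, mulO_smul_right, mulO_smul_left]
    split_ifs with hk
    · rw [mulO_comm_z hp z (sg j f), sg_mulO hp, add_sub_cancel_right]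
    · rw [mulO_zero_right, add_zero, sub_zero]

lemma up_ev [NeZero p] (hp : 1 < p) (g : O F p m n) (i : Fin m) (l : Mon p m n)
    (h : (l.1 i : ℕ) + 1 < p) :
    mulO g (xVar (Fin.castAdd n i)) (Function.update l.1 i ⟨(l.1 i : ℕ) + 1, h⟩, l.2)
      = (((l.1 i : ℕ) + 1 : ℕ) : F) * g l := by
  rw [mulO_ev hp]
  have : dn i ((Function.update l.1 i ⟨(l.1 i : ℕ) + 1, h⟩, l.2) : Mon p m n) = l := by
    refine Prod.ext (funext fun k => Fin.ext ?_) rfl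
    by_cases hk : k = i
    · subst hk; simp [dn]
    · simp [dn]
  rw [this]; simp

lemma x_inj [NeZero p] [CharP F p] (hp : 3 < p) (z : Fin m) (g h : O F p m n)
    (hg : inO 1 g) (hh : inO 1 h)
    (e : mulO g (xVar (Fin.castAdd n z)) = mulO h (xVar (Fin.castAdd n z))) : g = h := by
  funext l
  by_cases hl : zdMon l = 1
  · have h1 := le_zd l z
    have h2 : (l.1 z : ℕ) + 1 < p := by omega
    have h3 := congrFun e (Function.update l.1 z ⟨(l.1 z : ℕ) + 1, h2⟩, l.2)
    rw [up_ev (by omega), up_ev (by omega)] at h3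
    exact mul_left_cancel₀ (cast_ne _ (by omega) h2) h3
  · have h1 : g l = 0 := by
      by_contra h; exact hl (by exact_mod_cast hg l h)
    have h2 : h l = 0 := by
      by_contra h; exact hl (by exact_mod_cast hh l h)
    rw [h1, h2]

lemma pd_ex [NeZero p] (z : Fin m) (μ : Mon p m n)
    (h : μ.2 ≠ ∅ ∨ ∃ i, i ≠ z ∧ (μ.1 i : ℕ) ≠ 0) :
    ∃ (j : Fin (m + n)) (l : Mon p m n) (c : F), j ≠ Fin.castAdd n z ∧ c ≠ 0 ∧ l.1 z = μ.1 z ∧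
      ∀ f : O F p m n, pd j f l = c * f μ := by
  rcases h with h | ⟨i, hi, h0⟩
  · obtain ⟨i, hi⟩ := Finset.nonempty_iff_ne_empty.mpr h
    refine ⟨Fin.natAdd m i, (μ.1, μ.2.erase i),
      (-1) ^ ((μ.2.erase i).filter fun j => j < i).card, ?_, ?_, rfl, fun f => ?_⟩
    rotate_left 2
    · rw [pd_od, if_neg (by simp)]
      simp only [Finset.insert_erase hi]
    · have := z.isLt
      simp [Fin.ext_iff]; omega
    · exact pow_ne_zero _ (by simp)
  · refine ⟨Fin.castAdd n i, dn i μ, 1, ?_, one_ne_zero, ?_, fun f => ?_⟩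
    · simpa [Fin.ext_iff] using hi
    · simp [dn, Function.update_of_ne hi.symm]
    · have h3 : (((dn i μ).1 i : Fin p) : ℕ) = (μ.1 i : ℕ) - 1 := by simp [dn]
      have h3' : (((dn i μ).1 i : Fin p) : ℕ) + 1 < p := by
        have := (μ.1 i).isLt; omega
      have h4 : (Function.update (dn i μ).1 i ⟨(((dn i μ).1 i : Fin p) : ℕ) + 1, h3'⟩,
          (dn i μ).2) = μ := by
        refine Prod.ext (funext fun k => Fin.ext ?_) rfl
        by_cases hk : k = i
        · subst hk; simp [dn]; omega
        · simp [dn, hk]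
      rw [pd_ev, dif_pos h3', h4, one_mul]

lemma ex_mem (z : Fin m) (μ : Mon p m n) (h2 : zdMon μ = 2) (hz : (μ.1 z : ℕ) ≠ 2) :
    μ.2 ≠ ∅ ∨ ∃ i, i ≠ z ∧ (μ.1 i : ℕ) ≠ 0 := by
  by_contra! h
  obtain ⟨ha, hb⟩ := h
  simp only [zdMon, ha, Finset.card_empty] at h2
  rw [Finset.sum_eq_single z (fun b _ hbz => hb b hbz) (by simp)] at h2
  omega

lemma bracket_sub [NeZero p] [CharP F p] (hp : 1 < p) (z : Fin m) (j : Fin (m + n))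
    (D E : W F p m n) :
    bracketW (xd z j) (D + E) = bracketW (xd z j) D + bracketW (xd z j) E := by
  funext k
  simp only [Pi.add_apply, bracket_xd hp, pd_add, mulO_add_right]
  split_ifs
  · have : sg j (D (Fin.castAdd n z) + E (Fin.castAdd n z))
        = sg j (D (Fin.castAdd n z)) + sg j (E (Fin.castAdd n z)) := by
      funext μ; simp only [sg, Pi.add_apply]; ring
    rw [this]; abel
  · abel

lemma mulO_xx [NeZero p] (hp : 2 < p) (z : Fin m) (μ : Mon p m n) :
    mulO (xVar (Fin.castAdd n z)) (xVar (Fin.castAdd n z)) μ =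
      if μ = ((Pi.single z ⟨2, hp⟩ : Fin m → Fin p), (∅ : Finset (Fin n)))
      then (2 : F) else 0 := by
  rw [mulO_ev (by omega), xVar_ev]
  split_ifs with h1 h2 h2
  · subst h2; simp
  · by_cases h0 : (μ.1 z : ℕ) = 0
    · simp [h0]
    · exfalso; apply h2
      refine Prod.ext (funext fun k => Fin.ext ?_) (by simpa [dn] using congrArg Prod.snd h1)
      have h3 := congrArg Fin.val (congrFun (congrArg Prod.fst h1) k)
      rw [val_single (by omega)] at h3
      by_cases hk : k = z
      · subst hk; simp [dn] at h3 ⊢; omega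
      · simpa [dn, hk] using h3
  · exfalso; apply h1
    subst h2
    refine Prod.ext (funext fun k => Fin.ext ?_) rfl
    rw [val_single (by omega)]
    by_cases hk : k = z
    · subst hk; simp [dn]
    · simp [dn, hk]
  · simp

lemma star [NeZero p] [CharP F p] (hp : 3 < p) (hm : 2 ≤ m) (hn : 2 ≤ n) (z : Fin m)
    (j : Fin (m + n)) (g : O F p m n) (D : W F p m n) (hg : inO 1 g)
    (hb : bracketW (xd z j) D = fEuler g) (l : Mon p m n) (hl : (l.1 z : ℕ) = 0) : g l = 0 := by
  by_contra hne
  have hzd : zdMon l = 1 := by exact_mod_cast hg l hne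
  have key : ∀ k, k ≠ j → ∀ μ : Mon p m n, (μ.1 z : ℕ) = 0 → mulO g (xVar k) μ = 0 := by
    intro k hk μ hμ
    have h1 := congrFun (congrFun hb k) μ
    rw [bracket_xd (by omega), if_neg hk, sub_zero, mulO_x_left (by omega), hμ] at h1
    simpa [fEuler] using h1.symm
  induction j using Fin.addCases with
  | left j =>
    have : ∃ k : Fin n, k ∉ l.2 := by
      by_contra! h
      have h1 : l.2 = univ := by ext; simp [h]
      have h2 := le_zd l z
      rw [h1] at h2; simp at h2; omega
    obtain ⟨k, hk⟩ := this
    have h1 := key (Fin.natAdd m k) (by have := j.isLt; simp [Fin.ext_iff]; omega)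
      (l.1, insert k l.2) hl
    rw [mulO_od] at h1
    simp [Finset.erase_insert hk, hne] at h1
  | right j =>
    have : ∃ k : Fin m, k ≠ z := by
      have : Nontrivial (Fin m) := Fin.nontrivial_iff_two_le.mpr hm
      exact exists_ne z
    obtain ⟨k, hk⟩ := this
    have h2 := le_zd l k
    have h3 : (l.1 k : ℕ) + 1 < p := by omega
    have h1 := key (Fin.castAdd n k) (by have := k.isLt; simp [Fin.ext_iff]; omega)
      (Function.update l.1 k ⟨(l.1 k : ℕ) + 1, h3⟩, l.2)
      (by simp only [Function.update_of_ne hk.symm, hl])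
    rw [up_ev (by omega)] at h1
    exact mul_ne_zero (cast_ne _ (by omega) h3) hne h1

lemma main [NeZero p] [CharP F p] (hp : 3 < p) (hm : 2 ≤ m) (hn : 2 ≤ n) (z : Fin m)
    (D : W F p m n) (hD : inW 1 D) :
    (∀ j : Fin (m + n), j ≠ Fin.castAdd n z →
        ∃ g : O F p m n, inO 1 g ∧ bracketW (xd z j) D = fEuler g)
    ↔ ∃ (f : O F p m n) (kk : Fin (m + n) → F), inO 1 f ∧
        D = fEuler f + (fun j : Fin (m + n) => if j ≠ Fin.castAdd n z then
              kk j • mulO (xVar (Fin.castAdd n z)) (xVar (Fin.castAdd n z)) else 0) := by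
  have hp1 : 1 < p := by omega
  constructor
  · intro H
    have hD0 : ∀ k, inO (1 + 1) (D k) := hD
    -- the coefficients of `D 0` not divisible by `x_1` vanish
    have S : ∀ μ : Mon p m n, (μ.1 z : ℕ) = 0 → D (Fin.castAdd n z) μ = 0 := by
      intro μ hμ
      by_contra hne
      have h2 : zdMon μ = 2 := by
        have := hD0 _ μ hne
        omega
      obtain ⟨j, l, c, hj, hc, hl, hf⟩ := pd_ex (F := F) z μ (ex_mem z μ h2 (by omega))
      obtain ⟨g, hg, hb⟩ := H j hj
      have h0 := congrFun hb (Fin.castAdd n z)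
      rw [bracket_xd hp1, if_neg hj.symm, sub_zero, mulO_comm_z hp1] at h0
      have h3 := x_inj hp z _ _ (inO_pd 1 j _ (hD0 _)) hg h0
      have h4 := star hp hm hn z j g D hg hb l (by rw [hl, hμ])
      rw [← h3, hf] at h4
      exact mul_ne_zero hc hne h4
    let f : O F p m n := fun l => pd (Fin.castAdd n z) (D (Fin.castAdd n z)) l
      / (((l.1 z : ℕ) + 1 : ℕ) : F)
    have hf : inO 1 f := by
      intro l hl
      refine inO_pd 1 (Fin.castAdd n z) (D (Fin.castAdd n z)) (hD0 _) l (fun h => hl ?_)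
      simp [f, h]
    have hf0 : mulO f (xVar (Fin.castAdd n z)) = D (Fin.castAdd n z) := by
      funext μ
      rw [mulO_ev hp1]
      by_cases h0 : (μ.1 z : ℕ) = 0
      · rw [S μ h0, h0]; simp
      · have h3 : (((dn z μ).1 z : Fin p) : ℕ) = (μ.1 z : ℕ) - 1 := by simp [dn]
        have h3' : (((dn z μ).1 z : Fin p) : ℕ) + 1 < p := by
          have := (μ.1 z).isLt; omega
        have h4 : (Function.update (dn z μ).1 z ⟨(((dn z μ).1 z : Fin p) : ℕ) + 1, h3'⟩,
            (dn z μ).2) = μ := by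
          refine Prod.ext (funext fun k => Fin.ext ?_) rfl
          by_cases hk : k = z
          · subst hk; simp [dn]; omega
          · simp [dn, hk]
        have h5 : (((dn z μ).1 z : Fin p) : ℕ) + 1 = (μ.1 z : ℕ) := by omega
        simp only [f]
        rw [pd_ev, dif_pos h3', h4, h5]
        exact mul_div_cancel₀ _ (cast_ne _ (by omega) (μ.1 z).isLt)
    obtain ⟨E, hE⟩ : ∃ E : W F p m n, D = fEuler f + E := ⟨D - fEuler f, by abel⟩
    have hE0 : E (Fin.castAdd n z) = 0 := by
      have := congrFun hE (Fin.castAdd n z)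
      simp only [Pi.add_apply, fEuler, hf0] at this
      exact left_eq_add.mp this
    have hEd : ∀ k, inO (1 + 1) (E k) := by
      intro k μ h
      have h1 := congrFun (congrFun hE k) μ
      simp only [Pi.add_apply, fEuler] at h1
      by_cases h2 : D k μ = 0
      · refine inO_mulO hp1 f k hf μ (fun h3 => h ?_)
        rw [h2, h3, zero_add] at h1
        exact h1.symm
      · exact hD0 k μ h2
    have hpd : ∀ j, j ≠ Fin.castAdd n z → ∀ k, pd j (E k) = 0 := by
      intro j hj k
      obtain ⟨g, hg, hb⟩ := H j hj
      obtain ⟨c, hc⟩ := bracket_fEuler hp1 z j f hf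
      rw [hE, bracket_sub hp1, hc] at hb
      have h0 := congrFun hb (Fin.castAdd n z)
      rw [Pi.add_apply, bracket_xd hp1, if_neg hj.symm, hE0, pd_zero, mulO_zero_right, sub_zero,
        add_zero] at h0
      have h1 := x_inj hp z _ _ (inO_xVar hp1 c z) hg h0
      rw [← h1] at hb
      have h2 := congrFun (add_eq_left.mp hb) k
      have h3 : sg j (0 : O F p m n) = 0 := by funext μ; simp [sg]
      rw [bracket_xd hp1, hE0, h3, ite_self, sub_zero, mulO_comm_z hp1, Pi.zero_apply,
        ← mulO_zero_left (xVar (Fin.castAdd n z))] at h2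
      exact x_inj hp z _ _ (inO_pd 1 j _ (hEd k)) (by intro μ h; simp at h) h2
    have hp2 : 2 < p := by omega
    refine ⟨f, fun k => E k ((Pi.single z ⟨2, hp2⟩ : Fin m → Fin p), (∅ : Finset (Fin n))) / 2,
      hf, ?_⟩
    rw [hE]; congr 1
    funext k
    by_cases hk : k = Fin.castAdd n z
    · simp [hk, hE0]
    · rw [if_pos hk]
      funext μ
      simp only [Pi.smul_apply, smul_eq_mul, mulO_xx hp2]
      have h2F : (2 : F) ≠ 0 := by exact_mod_cast cast_ne (F := F) (p := p) 2 (by omega) hp2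
      split_ifs with hμ
      · rw [hμ]; field_simp
      · rw [mul_zero]
        by_contra hne
        have h2 : zdMon μ = 2 := by
          have := hEd _ μ hne
          omega
        have h3 : μ.2 ≠ ∅ ∨ ∃ i, i ≠ z ∧ (μ.1 i : ℕ) ≠ 0 := by
          by_contra! h
          apply hμ
          have h5 : (μ.1 z : ℕ) = 2 := by
            by_contra h4
            rcases ex_mem z μ h2 h4 with h6 | ⟨i, hi, h6⟩
            · exact h6 h.1
            · exact h6 (h.2 i hi)
          refine Prod.ext (funext fun i => Fin.ext ?_) h.1
          by_cases hi : i = z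
          · subst hi; simp [h5]
          · simp [hi, h.2 i hi]
        obtain ⟨j, l, c, hj, hc, hl, hf⟩ := pd_ex (F := F) z μ h3
        have h6 := hf (E k)
        rw [hpd j hj k] at h6
        exact mul_ne_zero hc hne h6.symm
  · rintro ⟨f, kk, hf, rfl⟩ j hj
    obtain ⟨c, hc⟩ := bracket_fEuler hp1 z j f hf
    refine ⟨_, inO_xVar hp1 c z, ?_⟩
    rw [bracket_sub hp1, hc]
    apply add_eq_left.mpr
    funext k
    have h1 : pd j (mulO (xVar (Fin.castAdd n z)) (xVar (Fin.castAdd n z)) : O F p m n) = 0 := by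
      rw [leib hp1, pd_xVar hp1, if_neg hj.symm, if_neg hj.symm, mulO_zero_left, add_zero]
    have h3 : sg j (0 : O F p m n) = 0 := by funext μ; simp [sg]
    rw [bracket_xd hp1]
    simp only [ne_eq, not_true, if_false, h3, ite_self, sub_zero]
    split_ifs
    · rw [pd_zero, mulO_zero_right]; rfl
    · rw [pd_smul, h1, smul_zero, mulO_zero_right]; rfl

/-- for `D ∈ W_1`, `[x_1∂_j, D] ∈ W_1'' = {f𝔇 : f ∈ O_1}` for all `j ≥ 2`
iff `D = f𝔇 + x_1²·∑_{j≥2} k_j ∂_j` for some `f ∈ O_1` and scalars `k_j`. -/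
theorem bracket_x1dj_in_Wpp_iff (F : Type*) [Field F] (p m n : ℕ) [Fact p.Prime]
    [CharP F p] (hp : 3 < p) (hm : 2 ≤ m) (hn : 2 ≤ n)
    (D : W F p m n) (hD : inW 1 D) :
    (∀ j : Fin (m + n), 1 ≤ (j : ℕ) →
        ∃ g : O F p m n, inO 1 g ∧
          bracketW
            ((fun k => if k = j then xVar (⟨0, by omega⟩ : Fin (m + n)) else 0) : W F p m n)
            D = fEuler g)
    ↔ ∃ (f : O F p m n) (kk : Fin (m + n) → F), inO 1 f ∧
        D = fEuler f +
          (fun j : Fin (m + n) => if 1 ≤ (j : ℕ) then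
              kk j • mulO (xVar (⟨0, by omega⟩ : Fin (m + n)))
                (xVar (⟨0, by omega⟩ : Fin (m + n)))
            else 0) := by
  have h := main (F := F) (p := p) hp hm hn (⟨0, by omega⟩ : Fin m) D hD
  have e : ∀ j : Fin (m + n), j ≠ Fin.castAdd n (⟨0, by omega⟩ : Fin m) ↔ 1 ≤ (j : ℕ) := by
    intro j
    simp only [ne_eq, Fin.ext_iff, Fin.val_castAdd]
    omega
  simp only [e] at h
  exact h

end Cartan
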